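/- Let A be an m×n real matrix and θ > 0. Then the dual norm ‖A‖_θ* equals the optimal value of the problem: minimize max{‖Y‖, θ⁻¹‖Z‖_∞} over all m×n matrices Y, Z satisfying Y + Z = A, where ‖Y‖ is the spectral norm of Y and ‖Z‖_∞ is the entrywise max norm of Z. -/

import Mathlib

open scoped BigOperators

noncomputable section

namespace LAROS

variable {m n : ℕ}

/-- Trace inner product `⟨A,X⟩ = trace(Aᵀ X)`. -/
def mInner (A X : Matrix (Fin m) (Fin n) ℝ) : ℝ := ∑ i, ∑ j, A i j * X i j

/-- `N` is a norm on `m×n` real matrices. -/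
def IsMatrixNorm (N : Matrix (Fin m) (Fin n) ℝ → ℝ) : Prop :=
  (∀ X, N X = 0 ↔ X = 0) ∧ (∀ (c : ℝ) (X), N (c • X) = |c| * N X) ∧
    (∀ X Y, N (X + Y) ≤ N X + N Y)

/-- Dual norm of `N`. -/
def dualNorm (N : Matrix (Fin m) (Fin n) ℝ → ℝ) (A : Matrix (Fin m) (Fin n) ℝ) : ℝ :=
  sSup {r | ∃ Y, N Y ≤ 1 ∧ r = mInner A Y}

/-- `X` is optimal for: minimize `N X` subject to `⟨A,X⟩ ≥ 1`. -/
def IsOptMin (N : Matrix (Fin m) (Fin n) ℝ → ℝ) (A X : Matrix (Fin m) (Fin n) ℝ) : Prop :=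
  1 ≤ mInner A X ∧ ∀ X', 1 ≤ mInner A X' → N X ≤ N X'

/-- `Y` is optimal for: maximize `⟨A,Y⟩` subject to `N Y ≤ 1`. -/
def IsOptMax (N : Matrix (Fin m) (Fin n) ℝ → ℝ) (A Y : Matrix (Fin m) (Fin n) ℝ) : Prop :=
  N Y ≤ 1 ∧ ∀ Y', N Y' ≤ 1 → mInner A Y' ≤ mInner A Y

/-- Subdifferential of `f : ℝ^{m×n} → ℝ` at `A`, with respect to the trace inner product. -/
def subdiff (f : Matrix (Fin m) (Fin n) ℝ → ℝ) (A : Matrix (Fin m) (Fin n) ℝ) :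
    Set (Matrix (Fin m) (Fin n) ℝ) :=
  {Y | ∀ B, f A + mInner (B - A) Y ≤ f B}

/-- The spectral norm (largest singular value) of an `m×n` real matrix. -/
def spectralNorm (A : Matrix (Fin m) (Fin n) ℝ) : ℝ :=
  sSup {r | ∃ (u : Fin m → ℝ) (v : Fin n → ℝ),
    (∑ i, u i ^ 2) ≤ 1 ∧ (∑ j, v j ^ 2) ≤ 1 ∧ r = ∑ i, ∑ j, u i * A i j * v j}

/-- The nuclear norm (sum of singular values), as the dual norm of the spectral norm. -/
def nuclearNorm (A : Matrix (Fin m) (Fin n) ℝ) : ℝ := dualNorm spectralNorm A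

/-- Entrywise ℓ1 norm: sum of absolute values of all entries. -/
def l1Norm (X : Matrix (Fin m) (Fin n) ℝ) : ℝ := ∑ i, ∑ j, |X i j|

/-- Entrywise max norm: maximum absolute value of an entry. -/
def maxNorm (X : Matrix (Fin m) (Fin n) ℝ) : ℝ := sSup {r | ∃ i j, r = |X i j|}

/-- The norm `‖X‖_θ = ‖X‖_* + θ‖X‖₁`. -/
def thetaNorm (θ : ℝ) (X : Matrix (Fin m) (Fin n) ℝ) : ℝ := nuclearNorm X + θ * l1Norm X

/-! ### The trace inner product -/

lemma mInner_comm (A X : Matrix (Fin m) (Fin n) ℝ) : mInner A X = mInner X A := by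
  simp only [mInner, mul_comm]

lemma mInner_add_left (A B X : Matrix (Fin m) (Fin n) ℝ) :
    mInner (A + B) X = mInner A X + mInner B X := by
  simp only [mInner, Matrix.add_apply, add_mul, Finset.sum_add_distrib]

lemma mInner_smul_left (c : ℝ) (A X : Matrix (Fin m) (Fin n) ℝ) :
    mInner (c • A) X = c * mInner A X := by
  simp only [mInner, Matrix.smul_apply, smul_eq_mul, mul_assoc, Finset.mul_sum]

lemma mInner_smul_right (c : ℝ) (A X : Matrix (Fin m) (Fin n) ℝ) :
    mInner A (c • X) = c * mInner A X := by
  rw [mInner_comm, mInner_smul_left, mInner_comm]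

lemma mInner_le_mul_l1Norm {A X : Matrix (Fin m) (Fin n) ℝ} {c : ℝ}
    (h : ∀ i j, |A i j| ≤ c) : mInner A X ≤ c * l1Norm X := by
  simp only [mInner, l1Norm, Finset.mul_sum]
  refine Finset.sum_le_sum fun i _ => Finset.sum_le_sum fun j _ => ?_
  calc A i j * X i j ≤ |A i j| * |X i j| := by rw [← abs_mul]; exact le_abs_self _
    _ ≤ c * |X i j| := mul_le_mul_of_nonneg_right (h i j) (abs_nonneg _)

/-- Every linear functional on matrices is represented by the trace inner product. -/
lemma exists_eq_mInner (f : (Fin m → Fin n → ℝ) →ₗ[ℝ] ℝ) :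
    ∃ X : Matrix (Fin m) (Fin n) ℝ, ∀ B : Matrix (Fin m) (Fin n) ℝ, f B = mInner B X := by
  refine ⟨fun i j => f (Pi.single i (Pi.single j 1)), fun B => ?_⟩
  have hB : (B : Fin m → Fin n → ℝ) =
      ∑ i, ∑ j, B i j • (Pi.single i (Pi.single j 1) : Fin m → Fin n → ℝ) := by
    ext k l
    simp only [Finset.sum_apply, Pi.smul_apply, Pi.single_apply, smul_eq_mul]
    simp [ite_apply, Pi.single_apply]
  conv_lhs => rw [hB]
  simp only [map_sum, map_smul, smul_eq_mul, mInner]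

/-! ### The entrywise norms -/

lemma l1Norm_nonneg (X : Matrix (Fin m) (Fin n) ℝ) : 0 ≤ l1Norm X :=
  Finset.sum_nonneg fun _ _ => Finset.sum_nonneg fun _ _ => abs_nonneg _

lemma abs_apply_le_l1Norm (X : Matrix (Fin m) (Fin n) ℝ) (i : Fin m) (j : Fin n) :
    |X i j| ≤ l1Norm X :=
  (Finset.single_le_sum (f := fun j => |X i j|) (fun _ _ => abs_nonneg _)
    (Finset.mem_univ j)).trans
    (Finset.single_le_sum (f := fun i => ∑ j, |X i j|)
      (fun _ _ => Finset.sum_nonneg fun _ _ => abs_nonneg _) (Finset.mem_univ i))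

lemma l1Norm_smul (c : ℝ) (X : Matrix (Fin m) (Fin n) ℝ) :
    l1Norm (c • X) = |c| * l1Norm X := by
  simp only [l1Norm, Matrix.smul_apply, smul_eq_mul, abs_mul, Finset.mul_sum]

lemma abs_apply_le_maxNorm (X : Matrix (Fin m) (Fin n) ℝ) (i : Fin m) (j : Fin n) :
    |X i j| ≤ maxNorm X := by
  refine le_csSup ⟨l1Norm X, ?_⟩ ⟨i, j, rfl⟩
  rintro _ ⟨i, j, rfl⟩
  exact abs_apply_le_l1Norm X i j

lemma maxNorm_le {X : Matrix (Fin m) (Fin n) ℝ} {c : ℝ} (hc : 0 ≤ c)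
    (h : ∀ i j, |X i j| ≤ c) : maxNorm X ≤ c := by
  refine Real.sSup_le ?_ hc
  rintro _ ⟨i, j, rfl⟩
  exact h i j

/-! ### The spectral norm -/

lemma bilin_le_spectralNorm (A : Matrix (Fin m) (Fin n) ℝ) {u : Fin m → ℝ} {v : Fin n → ℝ}
    (hu : ∑ i, u i ^ 2 ≤ 1) (hv : ∑ j, v j ^ 2 ≤ 1) :
    ∑ i, ∑ j, u i * A i j * v j ≤ spectralNorm A := by
  refine le_csSup ⟨l1Norm A, ?_⟩ ⟨u, v, hu, hv, rfl⟩
  rintro _ ⟨u, v, hu, hv, rfl⟩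
  have abs_le_one : ∀ {k : ℕ} {w : Fin k → ℝ}, ∑ i, w i ^ 2 ≤ 1 → ∀ i, |w i| ≤ 1 := by
    intro k w hw i
    rw [← sq_le_one_iff_abs_le_one]
    exact (Finset.single_le_sum (f := fun i => w i ^ 2) (fun _ _ => sq_nonneg _)
      (Finset.mem_univ i)).trans hw
  refine Finset.sum_le_sum fun i _ => Finset.sum_le_sum fun j _ => ?_
  calc u i * A i j * v j ≤ |u i| * |A i j| * |v j| := by
        rw [← abs_mul, ← abs_mul]; exact le_abs_self _
    _ ≤ 1 * |A i j| * 1 := by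
        gcongr
        exacts [abs_le_one hu i, abs_le_one hv j]
    _ = |A i j| := by ring

lemma spectralNorm_le {A : Matrix (Fin m) (Fin n) ℝ} {c : ℝ}
    (h : ∀ (u : Fin m → ℝ) (v : Fin n → ℝ), ∑ i, u i ^ 2 ≤ 1 → ∑ j, v j ^ 2 ≤ 1 →
      ∑ i, ∑ j, u i * A i j * v j ≤ c) : spectralNorm A ≤ c := by
  refine csSup_le ⟨0, 0, 0, by simp, by simp, by simp⟩ ?_
  rintro _ ⟨u, v, hu, hv, rfl⟩
  exact h u v hu hv

lemma spectralNorm_nonneg (A : Matrix (Fin m) (Fin n) ℝ) : 0 ≤ spectralNorm A := by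
  simpa using bilin_le_spectralNorm A (u := 0) (v := 0) (by simp) (by simp)

lemma abs_apply_le_spectralNorm (A : Matrix (Fin m) (Fin n) ℝ) (i : Fin m) (j : Fin n) :
    |A i j| ≤ spectralNorm A := by
  have key : ∀ c : ℝ, c ^ 2 ≤ 1 → c * A i j ≤ spectralNorm A := by
    intro c hc
    have := bilin_le_spectralNorm A (u := Pi.single i c) (v := Pi.single j 1)
      (by simpa [Pi.single_apply, ite_pow] using hc) (by simp [Pi.single_apply, ite_pow])
    simpa [Pi.single_apply] using this
  rw [abs_le']
  exact ⟨by simpa using key 1 (by norm_num), by simpa using key (-1) (by norm_num)⟩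

lemma bilin_smul (c : ℝ) (A : Matrix (Fin m) (Fin n) ℝ) (u : Fin m → ℝ) (v : Fin n → ℝ) :
    ∑ i, ∑ j, u i * (c • A) i j * v j = c * ∑ i, ∑ j, u i * A i j * v j := by
  simp only [Matrix.smul_apply, smul_eq_mul, Finset.mul_sum]
  exact Finset.sum_congr rfl fun _ _ => Finset.sum_congr rfl fun _ _ => by ring

lemma bilin_add (A B : Matrix (Fin m) (Fin n) ℝ) (u : Fin m → ℝ) (v : Fin n → ℝ) :
    ∑ i, ∑ j, u i * (A + B) i j * v j =
      ∑ i, ∑ j, u i * A i j * v j + ∑ i, ∑ j, u i * B i j * v j := by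
  simp only [Matrix.add_apply, mul_add, add_mul, Finset.sum_add_distrib]

lemma spectralNorm_smul_le {c : ℝ} (hc : 0 ≤ c) (A : Matrix (Fin m) (Fin n) ℝ) :
    spectralNorm (c • A) ≤ c * spectralNorm A := by
  refine spectralNorm_le fun u v hu hv => ?_
  rw [bilin_smul]
  exact mul_le_mul_of_nonneg_left (bilin_le_spectralNorm A hu hv) hc

lemma spectralNorm_add_le (A B : Matrix (Fin m) (Fin n) ℝ) :
    spectralNorm (A + B) ≤ spectralNorm A + spectralNorm B := by
  refine spectralNorm_le fun u v hu hv => ?_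
  rw [bilin_add]
  exact add_le_add (bilin_le_spectralNorm A hu hv) (bilin_le_spectralNorm B hu hv)

lemma convex_spectralNorm_le (s : ℝ) :
    Convex ℝ {Y : Fin m → Fin n → ℝ | spectralNorm (m := m) (n := n) Y ≤ s} := by
  intro Y hY Z hZ a b ha hb hab
  calc spectralNorm (m := m) (n := n) (a • Y + b • Z)
      ≤ a * spectralNorm (m := m) (n := n) Y + b * spectralNorm (m := m) (n := n) Z :=
        (spectralNorm_add_le _ _).trans
          (add_le_add (spectralNorm_smul_le ha _) (spectralNorm_smul_le hb _))
    _ ≤ a * s + b * s :=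
        add_le_add (mul_le_mul_of_nonneg_left hY ha) (mul_le_mul_of_nonneg_left hZ hb)
    _ = s := by rw [← add_mul, hab, one_mul]

lemma isClosed_spectralNorm_le (s : ℝ) :
    IsClosed {Y : Fin m → Fin n → ℝ | spectralNorm (m := m) (n := n) Y ≤ s} := by
  have : {Y : Fin m → Fin n → ℝ | spectralNorm (m := m) (n := n) Y ≤ s} =
      {Y | ∀ (u : Fin m → ℝ) (v : Fin n → ℝ), ∑ i, u i ^ 2 ≤ 1 → ∑ j, v j ^ 2 ≤ 1 →
        ∑ i, ∑ j, u i * Y i j * v j ≤ s} :=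
    Set.ext fun Y => ⟨fun hY u v hu hv => (bilin_le_spectralNorm _ hu hv).trans hY,
      fun hY => spectralNorm_le hY⟩
  rw [this]
  simp only [Set.ofPred_forall]
  refine isClosed_iInter fun u => isClosed_iInter fun v => isClosed_iInter fun _ =>
    isClosed_iInter fun _ => isClosed_le ?_ continuous_const
  fun_prop

/-! ### Dual norms -/

/-- The generalized Cauchy–Schwarz inequality `⟨A,X⟩ ≤ N*(A) N(X)`. -/
lemma mInner_le_dualNorm_mul {N : Matrix (Fin m) (Fin n) ℝ → ℝ}
    (hsmul : ∀ c : ℝ, 0 ≤ c → ∀ X, N (c • X) ≤ c * N X) (hdef : ∀ X, N X ≤ 0 → X = 0)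
    (A : Matrix (Fin m) (Fin n) ℝ) (hbdd : BddAbove {r | ∃ Y, N Y ≤ 1 ∧ r = mInner A Y})
    (X : Matrix (Fin m) (Fin n) ℝ) : mInner A X ≤ dualNorm N A * N X := by
  rcases le_or_gt (N X) 0 with h | h
  · obtain rfl := hdef X h
    have h0 : N 0 = 0 := by
      refine le_antisymm h ?_
      have := hsmul 2 zero_le_two 0
      rw [smul_zero] at this
      linarith
    simp [h0, mInner]
  · have h1 : (N X)⁻¹ * mInner A X ≤ dualNorm N A := by
      refine le_csSup hbdd ⟨(N X)⁻¹ • X, ?_, (mInner_smul_right _ _ _).symm⟩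
      exact (hsmul _ (inv_nonneg.2 h.le) X).trans_eq (inv_mul_cancel₀ h.ne')
    rwa [inv_mul_le_iff₀ h, mul_comm] at h1

lemma bddAbove_nuclearNorm (X : Matrix (Fin m) (Fin n) ℝ) :
    BddAbove {r | ∃ Y, spectralNorm Y ≤ 1 ∧ r = mInner X Y} := by
  refine ⟨1 * l1Norm X, ?_⟩
  rintro _ ⟨Y, hY, rfl⟩
  rw [mInner_comm]
  exact mInner_le_mul_l1Norm fun i j => (abs_apply_le_spectralNorm Y i j).trans hY

lemma spectralNorm_zero_le : spectralNorm (0 : Matrix (Fin m) (Fin n) ℝ) ≤ 0 :=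
  spectralNorm_le fun _ _ _ _ => by simp

lemma nuclearNorm_nonneg (X : Matrix (Fin m) (Fin n) ℝ) : 0 ≤ nuclearNorm X :=
  le_csSup (bddAbove_nuclearNorm X)
    ⟨0, spectralNorm_zero_le.trans zero_le_one, by simp [mInner]⟩

lemma nuclearNorm_le {X : Matrix (Fin m) (Fin n) ℝ} {c : ℝ}
    (h : ∀ Y, spectralNorm Y ≤ 1 → mInner X Y ≤ c) : nuclearNorm X ≤ c := by
  refine csSup_le ⟨_, 0, spectralNorm_zero_le.trans zero_le_one, rfl⟩ ?_
  rintro _ ⟨Y, hY, rfl⟩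
  exact h Y hY

lemma nuclearNorm_smul_le {c : ℝ} (hc : 0 ≤ c) (X : Matrix (Fin m) (Fin n) ℝ) :
    nuclearNorm (c • X) ≤ c * nuclearNorm X := by
  refine nuclearNorm_le fun Y hY => ?_
  rw [mInner_smul_left]
  exact mul_le_mul_of_nonneg_left (le_csSup (bddAbove_nuclearNorm X) ⟨Y, hY, rfl⟩) hc

lemma mInner_le_spectralNorm_mul_nuclearNorm (Y X : Matrix (Fin m) (Fin n) ℝ) :
    mInner Y X ≤ spectralNorm Y * nuclearNorm X := by
  rw [mInner_comm, mul_comm]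
  refine mInner_le_dualNorm_mul (fun c hc X => spectralNorm_smul_le hc X) (fun X hX => ?_) X
    (bddAbove_nuclearNorm X) Y
  ext i j
  exact abs_nonpos_iff.1 ((abs_apply_le_spectralNorm X i j).trans hX)

lemma thetaNorm_smul_le (θ : ℝ) {c : ℝ} (hc : 0 ≤ c) (X : Matrix (Fin m) (Fin n) ℝ) :
    thetaNorm θ (c • X) ≤ c * thetaNorm θ X := by
  have := nuclearNorm_smul_le hc X
  rw [thetaNorm, thetaNorm, l1Norm_smul, abs_of_nonneg hc]
  linarith

lemma thetaNorm_nonneg {θ : ℝ} (hθ : 0 < θ) (X : Matrix (Fin m) (Fin n) ℝ) :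
    0 ≤ thetaNorm θ X :=
  add_nonneg (nuclearNorm_nonneg X) (mul_nonneg hθ.le (l1Norm_nonneg X))

lemma eq_zero_of_thetaNorm_nonpos {θ : ℝ} (hθ : 0 < θ) {X : Matrix (Fin m) (Fin n) ℝ}
    (hX : thetaNorm θ X ≤ 0) : X = 0 := by
  have h1 : θ * l1Norm X ≤ 0 := (le_add_of_nonneg_left (nuclearNorm_nonneg X)).trans hX
  have h2 : l1Norm X ≤ 0 := nonpos_of_mul_nonpos_right h1 hθ
  ext i j
  exact abs_nonpos_iff.1 ((abs_apply_le_l1Norm X i j).trans h2)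

/-- Weak duality. -/
lemma mInner_add_le_max_mul_thetaNorm {θ : ℝ} (hθ : 0 < θ)
    (Y Z X : Matrix (Fin m) (Fin n) ℝ) :
    mInner (Y + Z) X ≤ max (spectralNorm Y) (θ⁻¹ * maxNorm Z) * thetaNorm θ X := by
  set M := max (spectralNorm Y) (θ⁻¹ * maxNorm Z)
  have hZ : maxNorm Z ≤ M * θ := by
    rw [mul_comm, ← inv_mul_le_iff₀ hθ]
    exact le_max_right _ _
  calc mInner (Y + Z) X = mInner Y X + mInner Z X := mInner_add_left _ _ _
    _ ≤ M * nuclearNorm X + (M * θ) * l1Norm X :=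
        add_le_add
          ((mInner_le_spectralNorm_mul_nuclearNorm Y X).trans
            (mul_le_mul_of_nonneg_right (le_max_left _ _) (nuclearNorm_nonneg X)))
          (mInner_le_mul_l1Norm fun i j => (abs_apply_le_maxNorm Z i j).trans hZ)
    _ = M * thetaNorm θ X := by rw [thetaNorm]; ring

lemma mInner_add_le_max {θ : ℝ} (hθ : 0 < θ) (Y Z : Matrix (Fin m) (Fin n) ℝ)
    {X : Matrix (Fin m) (Fin n) ℝ} (hX : thetaNorm θ X ≤ 1) :
    mInner (Y + Z) X ≤ max (spectralNorm Y) (θ⁻¹ * maxNorm Z) :=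
  (mInner_add_le_max_mul_thetaNorm hθ Y Z X).trans
    (mul_le_of_le_one_right ((spectralNorm_nonneg Y).trans (le_max_left _ _)) hX)

lemma bddAbove_dualNorm_thetaNorm {θ : ℝ} (hθ : 0 < θ) (A : Matrix (Fin m) (Fin n) ℝ) :
    BddAbove {r | ∃ Y, thetaNorm θ Y ≤ 1 ∧ r = mInner A Y} := by
  refine ⟨max (spectralNorm A) (θ⁻¹ * maxNorm (0 : Matrix (Fin m) (Fin n) ℝ)), ?_⟩
  rintro _ ⟨X, hX, rfl⟩
  simpa only [add_zero] using mInner_add_le_max hθ A 0 hX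

lemma thetaNorm_zero_le (θ : ℝ) : thetaNorm θ (0 : Matrix (Fin m) (Fin n) ℝ) ≤ 0 := by
  simpa using thetaNorm_smul_le θ le_rfl (0 : Matrix (Fin m) (Fin n) ℝ)

lemma dualNorm_thetaNorm_nonneg {θ : ℝ} (hθ : 0 < θ) (A : Matrix (Fin m) (Fin n) ℝ) :
    0 ≤ dualNorm (thetaNorm θ) A :=
  le_csSup (bddAbove_dualNorm_thetaNorm hθ A)
    ⟨0, (thetaNorm_zero_le θ).trans zero_le_one, by simp [mInner]⟩

open scoped Pointwise in
/-- Strong duality: `A` splits with both parts of size at most any `s > ‖A‖_θ*`. -/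
lemma exists_add_eq_of_dualNorm_lt {θ s : ℝ} (hθ : 0 < θ) {A : Matrix (Fin m) (Fin n) ℝ}
    (hs : dualNorm (thetaNorm θ) A < s) :
    ∃ Y Z : Matrix (Fin m) (Fin n) ℝ, Y + Z = A ∧ spectralNorm Y ≤ s ∧
      ∀ i j, |Z i j| ≤ θ * s := by
  have hs0 : 0 < s := (dualNorm_thetaNorm_nonneg hθ A).trans_lt hs
  let S : Set (Fin m → Fin n → ℝ) := {Y | spectralNorm (m := m) (n := n) Y ≤ s}
  let T : Set (Fin m → Fin n → ℝ) :=
    Set.univ.pi fun _ => Set.univ.pi fun _ => Set.Icc (-(θ * s)) (θ * s)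
  have hT : IsCompact T := isCompact_univ_pi fun _ => isCompact_univ_pi fun _ => isCompact_Icc
  have hTconv : Convex ℝ T := convex_pi fun _ _ => convex_pi fun _ _ => convex_Icc _ _
  have hclosed : IsClosed (S + T) := (isClosed_spectralNorm_le s).add_right_of_isCompact hT
  have hconv : Convex ℝ (S + T) := (convex_spectralNorm_le s).add hTconv
  by_cases hA : (A : Fin m → Fin n → ℝ) ∈ S + T
  · obtain ⟨Y, hY, Z, hZ, h⟩ := hA
    exact ⟨Y, Z, h, hY, fun i j => abs_le.2 (hZ i trivial j trivial)⟩
  exfalso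
  obtain ⟨f, b, hf, hb⟩ := geometric_hahn_banach_closed_point hconv hclosed hA
  obtain ⟨X, hX⟩ := exists_eq_mInner f.toLinearMap
  let Z : Matrix (Fin m) (Fin n) ℝ := fun i j => θ * s * SignType.sign (X i j)
  have hZT : (Z : Fin m → Fin n → ℝ) ∈ T := by
    intro i _ j _
    have hpos : 0 ≤ θ * s := by positivity
    rcases lt_trichotomy (X i j) 0 with h | h | h <;> simp [Z, h, hpos]
  have hZX : mInner Z X = θ * s * l1Norm X := by
    simp only [mInner, l1Norm, Z, Finset.mul_sum, mul_assoc, sign_mul_self]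
  have hnuc : nuclearNorm X ≤ (b - θ * s * l1Norm X) / s := by
    refine nuclearNorm_le fun Y hY => ?_
    have hYS : ((s • Y : Matrix (Fin m) (Fin n) ℝ) : Fin m → Fin n → ℝ) ∈ S :=
      (spectralNorm_smul_le hs0.le Y).trans (mul_le_of_le_one_right hs0.le hY)
    have h1 : mInner (s • Y + Z) X < b := (hX (s • Y + Z)).symm.trans_lt
      (hf _ (Set.add_mem_add hYS hZT))
    rw [mInner_add_left, mInner_smul_left, hZX] at h1
    rw [le_div_iff₀ hs0, mInner_comm]
    linarith
  have hle : s * thetaNorm θ X ≤ b := by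
    rw [le_div_iff₀ hs0] at hnuc
    rw [thetaNorm]
    linarith
  have hlt : b < mInner A X := hb.trans_eq (hX A)
  have hdual : mInner A X ≤ dualNorm (thetaNorm θ) A * thetaNorm θ X :=
    mInner_le_dualNorm_mul (fun c hc X => thetaNorm_smul_le θ hc X)
      (fun X hX => eq_zero_of_thetaNorm_nonpos hθ hX) A (bddAbove_dualNorm_thetaNorm hθ A) X
  have := mul_le_mul_of_nonneg_right hs.le (thetaNorm_nonneg hθ X)
  linarith

theorem stmt7 (θ : ℝ) (hθ : 0 < θ) (A : Matrix (Fin m) (Fin n) ℝ) :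
    dualNorm (thetaNorm θ) A =
      sInf {r | ∃ Y Z : Matrix (Fin m) (Fin n) ℝ,
        Y + Z = A ∧ r = max (spectralNorm Y) (θ⁻¹ * maxNorm Z)} := by
  apply le_antisymm
  · refine csSup_le ⟨_, 0, (thetaNorm_zero_le θ).trans zero_le_one, rfl⟩ ?_
    rintro _ ⟨X, hX, rfl⟩
    refine le_csInf ⟨_, A, 0, add_zero A, rfl⟩ ?_
    rintro _ ⟨Y, Z, rfl, rfl⟩
    exact mInner_add_le_max hθ Y Z hX
  · refine le_of_forall_gt_imp_ge_of_dense fun s hs => ?_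
    obtain ⟨Y, Z, hYZ, hY, hZ⟩ := exists_add_eq_of_dualNorm_lt hθ hs
    have hs0 : 0 ≤ s := (dualNorm_thetaNorm_nonneg hθ A).trans hs.le
    refine csInf_le_of_le ⟨0, ?_⟩ ⟨Y, Z, hYZ, rfl⟩ (max_le hY ?_)
    · rintro _ ⟨Y, Z, -, rfl⟩
      exact (spectralNorm_nonneg Y).trans (le_max_left _ _)
    · rw [inv_mul_le_iff₀ hθ]
      exact maxNorm_le (mul_nonneg hθ.le hs0) hZ

end LAROS
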